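/- Let n ≥ 3 be an integer and K > 0. Define S = { λ ∈ ℝⁿ : Σ_{j=1}^n arctan λ_j ≥ (n−2)π/2 and |λ_j| ≤ K for all j }. Then S is a convex subset of ℝⁿ, and there exists a constant A > 0, depending only on n and K, such that the function λ ↦ −exp( −A · Σ_{j=1}^n arctan λ_j ) is concave on S. -/

import Mathlib

open Real

/-- In terms of `arccot = π / 2 - arctan`: `arccot x + arccot r ≤ arccot p`. -/
lemma pi_div_two_add_arctan_le_iff (x r p : ℝ) :
    π / 2 + arctan p ≤ arctan x + arctan r ↔ 0 < x + r ∧ p * (x + r) ≤ x * r - 1 := by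
  have hs : ∀ z, sin (arctan z) = z * cos (arctan z) := fun z => by
    rw [← tan_mul_cos (cos_arctan_pos z).ne', tan_arctan]
  have h1 : sin (arctan x + arctan r) = (cos (arctan x) * cos (arctan r)) * (x + r) := by
    rw [sin_add, hs, hs]; ring
  have h2 : sin (arctan x + arctan r - (π / 2 + arctan p)) =
      (cos (arctan x) * cos (arctan r) * cos (arctan p)) * (x * r - 1 - p * (x + r)) := by
    have : arctan x + arctan r - (π / 2 + arctan p)
        = (arctan x + arctan r - arctan p) - π / 2 := by ring
    rw [this, sin_sub_pi_div_two, cos_sub, cos_add, sin_add, hs, hs, hs]; ring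
  have c2 : 0 < cos (arctan x) * cos (arctan r) := mul_pos (cos_arctan_pos x) (cos_arctan_pos r)
  have c3 := mul_pos c2 (cos_arctan_pos p)
  have := arctan_lt_pi_div_two x
  have := arctan_lt_pi_div_two r
  have := arctan_lt_pi_div_two p
  have := neg_pi_div_two_lt_arctan x
  have := neg_pi_div_two_lt_arctan r
  have := neg_pi_div_two_lt_arctan p
  constructor
  · intro h
    constructor
    · have : 0 < sin (arctan x + arctan r) :=
        sin_pos_of_pos_of_lt_pi (by linarith) (by linarith)
      rw [h1] at this
      exact pos_of_mul_pos_right this c2.le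
    · have : 0 ≤ sin (arctan x + arctan r - (π / 2 + arctan p)) :=
        sin_nonneg_of_nonneg_of_le_pi (by linarith) (by linarith)
      rw [h2] at this
      linarith [nonneg_of_mul_nonneg_right this c3]
  · rintro ⟨hp, hq⟩
    have h3 : 0 < sin (arctan x + arctan r) := h1 ▸ mul_pos c2 hp
    have h4 : 0 ≤ sin (arctan x + arctan r - (π / 2 + arctan p)) :=
      h2 ▸ mul_nonneg c3.le (by linarith)
    have h5 : 0 < arctan x + arctan r := by
      by_contra! hc
      exact h3.not_ge (sin_nonpos_of_nonpos_of_neg_pi_le hc (by linarith))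
    by_contra! hc
    exact h4.not_gt (sin_neg_of_neg_of_neg_pi_lt (by linarith) (by linarith))

lemma convex_pi_div_two_add_arctan_le {x r p y s q a b : ℝ} (ha : 0 ≤ a) (hb : 0 ≤ b)
    (hab : a + b = 1) (h₁ : π / 2 + arctan p ≤ arctan x + arctan r)
    (h₂ : π / 2 + arctan q ≤ arctan y + arctan s) :
    π / 2 + arctan (a * p + b * q) ≤ arctan (a * x + b * y) + arctan (a * r + b * s) := by
  rw [pi_div_two_add_arctan_le_iff] at *
  obtain ⟨hS, hp⟩ := h₁
  obtain ⟨hR, hq⟩ := h₂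
  have hcross : 2 ≤ x * s + y * r - p * (y + s) - q * (x + r) := by
    have hSR := mul_pos hS hR
    have e1 := mul_le_mul_of_nonneg_right hp (sq_nonneg (y + s))
    have e2 := mul_le_mul_of_nonneg_right hq (sq_nonneg (x + r))
    have : 0 ≤ ((x + r) * (y + s)) * (x * s + y * r - p * (y + s) - q * (x + r) - 2) := by
      nlinarith [sq_nonneg ((x + r) - (y + s)), sq_nonneg (x * (y + s) - y * (x + r))]
    linarith [nonneg_of_mul_nonneg_right this hSR]
  constructor
  · rcases ha.eq_or_lt with rfl | ha
    · have : b = 1 := by linarith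
      subst this
      linarith
    · nlinarith [mul_pos ha hS, mul_nonneg hb hR.le]
  · have e1 := mul_le_mul_of_nonneg_left hp (mul_nonneg ha ha)
    have e2 := mul_le_mul_of_nonneg_left hq (mul_nonneg hb hb)
    have e3 := mul_le_mul_of_nonneg_left hcross (mul_nonneg ha hb)
    have e4 : a * a + b * b + a * b * 2 = 1 := by
      linear_combination (a + b + 1) * hab
    nlinarith

/-- Concavity of `lam ↦ cot (∑ arccot (lam j))`, stated through its hypograph. -/
lemma sum_arccot_le_convex {ι : Type*} {s : Finset ι} (hs : s.Nonempty) (lam mu : ι → ℝ)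
    {a b : ℝ} (ha : 0 ≤ a) (hb : 0 ≤ b) (hab : a + b = 1) (p q : ℝ)
    (h₁ : ∑ j ∈ s, (π / 2 - arctan (lam j)) ≤ π / 2 - arctan p)
    (h₂ : ∑ j ∈ s, (π / 2 - arctan (mu j)) ≤ π / 2 - arctan q) :
    ∑ j ∈ s, (π / 2 - arctan (a * lam j + b * mu j)) ≤ π / 2 - arctan (a * p + b * q) := by
  induction hs using Finset.Nonempty.cons_induction generalizing p q with
  | singleton i =>
    simp only [Finset.sum_singleton, sub_le_sub_iff_left, arctan_strictMono.le_iff_le] at *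
    nlinarith [mul_le_mul_of_nonneg_left h₁ ha, mul_le_mul_of_nonneg_left h₂ hb]
  | cons i s hi hs ih =>
    rw [Finset.sum_cons] at *
    have key : ∀ (nu : ι → ℝ) (w : ℝ),
        π / 2 - arctan (nu i) + ∑ j ∈ s, (π / 2 - arctan (nu j)) ≤ π / 2 - arctan w →
        ∃ r, ∑ j ∈ s, (π / 2 - arctan (nu j)) ≤ π / 2 - arctan r ∧
          π / 2 + arctan w ≤ arctan (nu i) + arctan r := by
      intro nu w h
      have hpos : 0 < ∑ j ∈ s, (π / 2 - arctan (nu j)) :=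
        Finset.sum_pos (fun j _ => sub_pos.2 (arctan_lt_pi_div_two _)) hs
      have := arctan_lt_pi_div_two (nu i)
      have := neg_pi_div_two_lt_arctan w
      refine ⟨tan (π / 2 - (arctan (nu i) - arctan w)), ?_⟩
      rw [arctan_tan (by linarith) (by linarith)]
      constructor <;> linarith
    obtain ⟨r, hr, hr'⟩ := key lam p h₁
    obtain ⟨t, ht, ht'⟩ := key mu q h₂
    have := ih r t hr ht
    have := convex_pi_div_two_add_arctan_le ha hb hab hr' ht'
    linarith

lemma sum_arccot_eq {n : ℕ} (lam : Fin n → ℝ) (i : Fin n) :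
    ∑ j ∈ Finset.univ.erase i, (π / 2 - arctan (lam j)) =
      n * π / 2 - ∑ j, arctan (lam j) - π / 2 + arctan (lam i) := by
  have := Finset.add_sum_erase Finset.univ (fun j => π / 2 - arctan (lam j)) (Finset.mem_univ i)
  simp only [Finset.sum_sub_distrib (s := Finset.univ), Finset.sum_const, Finset.card_univ,
    Fintype.card_fin, nsmul_eq_mul] at this
  linarith

lemma convex_sum_arctan_ge (n : ℕ) (hn : 2 ≤ n) :
    Convex ℝ {lam : Fin n → ℝ | ((n : ℝ) - 2) * π / 2 ≤ ∑ j, arctan (lam j)} := by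
  intro lam hl mu hm a b ha hb hab
  simp only [Set.mem_ofPred_eq, Pi.add_apply, Pi.smul_apply, smul_eq_mul] at *
  let i : Fin n := ⟨0, by omega⟩
  have hne : (Finset.univ.erase i).Nonempty := by
    rw [← Finset.card_pos, Finset.card_erase_of_mem (Finset.mem_univ i), Finset.card_univ,
      Fintype.card_fin]
    omega
  have h := sum_arccot_le_convex hne lam mu ha hb hab (-lam i) (-mu i)
    (by rw [sum_arccot_eq, arctan_neg]; linarith) (by rw [sum_arccot_eq, arctan_neg]; linarith)
  rw [sum_arccot_eq (fun j => a * lam j + b * mu j),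
    show a * -lam i + b * -mu i = -(a * lam i + b * mu i) by ring, arctan_neg] at h
  linarith

lemma exists_arctan_add_eq {t u : ℝ} (ht : 0 ≤ t) (hu : 0 ≤ u)
    (h : arctan t + arctan u < π / 2) :
    ∃ w, arctan t + arctan u = arctan w ∧ t + u + t * u * (t + u) ≤ w := by
  have htu : t * u < 1 := by
    rcases ht.eq_or_lt with rfl | ht
    · simp
    have h' : arctan u < arctan t⁻¹ := by rw [arctan_inv_of_pos ht]; linarith
    rw [arctan_strictMono.lt_iff_lt] at h'
    calc t * u < t * t⁻¹ := mul_lt_mul_of_pos_left h' ht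
      _ = 1 := mul_inv_cancel₀ ht.ne'
  refine ⟨_, arctan_add htu, ?_⟩
  rw [le_div_iff₀ (by linarith)]
  nlinarith [mul_nonneg (add_nonneg ht hu) (sq_nonneg (t * u))]

lemma sum_add_le_of_sum_arctan_add_le {ι : Type*} (s : Finset ι) (t : ι → ℝ) (τ : ℝ) :
    ∀ u, 0 ≤ u → (∀ i ∈ s, 0 ≤ t i) → ∑ i ∈ s, arctan (t i) + arctan u ≤ arctan τ →
      ∑ i ∈ s, t i + u ≤ τ := by
  induction s using Finset.cons_induction with
  | empty => intro u _ _ h; simpa [arctan_strictMono.le_iff_le] using h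
  | cons i s hi ih =>
    intro u hu ht h
    rw [Finset.sum_cons] at *
    have hti := ht i (Finset.mem_cons_self i s)
    have hts : ∀ j ∈ s, 0 ≤ t j := fun j hj => ht j (Finset.mem_cons_of_mem hj)
    have hsum : 0 ≤ ∑ j ∈ s, arctan (t j) :=
      Finset.sum_nonneg fun j hj => arctan_nonneg.2 (hts j hj)
    obtain ⟨w, hw, hw'⟩ := exists_arctan_add_eq hti hu
      (by linarith [arctan_lt_pi_div_two τ])
    have h0 := mul_nonneg (mul_nonneg hti hu) (add_nonneg hti hu)
    have := ih w (by linarith) hts (by linarith)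
    linarith

/-- Quantitative superadditivity of the tangent for at least two summands. -/
lemma sum_add_gap_le_of_sum_arctan_le {ι : Type*} [DecidableEq ι] {s : Finset ι} (hs : 1 < s.card)
    (t : ι → ℝ) {τ k : ℝ} (hk : 0 ≤ k) (ht : ∀ i ∈ s, k ≤ t i)
    (h : ∑ i ∈ s, arctan (t i) ≤ arctan τ) : ∑ i ∈ s, t i + 2 * k ^ 3 ≤ τ := by
  obtain ⟨a, ha, b, hb, hab⟩ := Finset.one_lt_card.1 hs
  have hb' : b ∈ s.erase a := Finset.mem_erase.2 ⟨hab.symm, hb⟩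
  have ht' : ∀ i ∈ (s.erase a).erase b, 0 ≤ t i := fun i hi =>
    hk.trans (ht i (Finset.mem_of_mem_erase (Finset.mem_of_mem_erase hi)))
  rw [← Finset.add_sum_erase s _ ha, ← Finset.add_sum_erase _ _ hb'] at *
  have hta := ht a ha
  have htb := ht b hb
  have hsum : 0 ≤ ∑ j ∈ (s.erase a).erase b, arctan (t j) :=
    Finset.sum_nonneg fun j hj => arctan_nonneg.2 (ht' j hj)
  obtain ⟨w, hw, hw'⟩ := exists_arctan_add_eq (hk.trans hta) (hk.trans htb)
    (by linarith [arctan_lt_pi_div_two τ])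
  have h1 : k * k ≤ t a * t b := mul_le_mul hta htb hk (hk.trans hta)
  have h2 : k * k * (k + k) ≤ t a * t b * (t a + t b) :=
    mul_le_mul h1 (by linarith) (by linarith) ((mul_nonneg hk hk).trans h1)
  have h3 : 0 ≤ k * k * (k + k) := by positivity
  have := sum_add_le_of_sum_arctan_add_le _ t τ w (by linarith) ht' (by linarith)
  nlinarith

lemma quadratic_form_nonneg {P T l A w x : ℝ} (hT : 0 < T) (hA : 0 < A)
    (hl : l * (T + 2 / A) ≤ 1) (hP : w ^ 2 ≤ P * T) (hl0 : 0 < l) :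
    0 ≤ A * (x + w) ^ 2 + 2 * (P - l * x ^ 2) := by
  have hl' : 2 * l ≤ A * (1 - l * T) := by
    have h := mul_le_mul_of_nonneg_left hl hA.le
    have : A * (l * (T + 2 / A)) = A * (l * T) + 2 * l := by field_simp
    linarith
  have hB : 0 < 2 + A * T := by positivity
  have hdisc : 2 ≤ (2 + A * T) * (1 - l * T) := by
    nlinarith [mul_le_mul_of_nonneg_right hl' hT.le]
  have hQ : 0 ≤ (2 + A * T) * (x + w) ^ 2 - 4 * (x + w) * x + 2 * (1 - l * T) * x ^ 2 := by
    refine nonneg_of_mul_nonneg_right (a := 2 + A * T) ?_ hB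
    nlinarith [sq_nonneg ((2 + A * T) * (x + w) - 2 * x),
      mul_le_mul_of_nonneg_right hdisc (sq_nonneg x)]
  refine nonneg_of_mul_nonneg_right (a := T) ?_ hT
  nlinarith

lemma exponentiated_arctan_hessian_nonneg {n : ℕ} (hn : 3 ≤ n) {K : ℝ} (hK : 0 < K)
    (lam v : Fin n → ℝ) (hlam : ((n : ℝ) - 2) * π / 2 ≤ ∑ j, arctan (lam j))
    (hbd : ∀ j, |lam j| ≤ K) :
    0 ≤ K ^ 3 * (∑ j, v j) ^ 2 + 2 * ∑ j, lam j * v j ^ 2 := by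
  by_cases hall : ∀ j, 0 ≤ lam j
  · have : 0 ≤ ∑ j, lam j * v j ^ 2 :=
      Finset.sum_nonneg fun j _ => mul_nonneg (hall j) (sq_nonneg _)
    positivity
  push Not at hall
  obtain ⟨j, hj⟩ := hall
  have hl0 : 0 < -lam j := by linarith
  set s := Finset.univ.erase j with hs
  have hcard : 1 < s.card := by
    rw [hs, Finset.card_erase_of_mem (Finset.mem_univ j), Finset.card_univ, Fintype.card_fin]
    omega
  have hsum : ∑ i ∈ s, (π / 2 - arctan (lam i)) ≤ π / 2 - arctan (-lam j) := by
    rw [sum_arccot_eq, arctan_neg]; linarith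
  have hpos : ∀ i ∈ s, 0 < lam i := fun i hi => by
    have h := (Finset.single_le_sum (f := fun i => π / 2 - arctan (lam i))
      (fun i _ => (sub_pos.2 (arctan_lt_pi_div_two _)).le) hi).trans hsum
    simp only [sub_le_sub_iff_left, arctan_strictMono.le_iff_le] at h
    linarith
  have hgap := sum_add_gap_le_of_sum_arctan_le hcard (fun i => (lam i)⁻¹) (τ := (-lam j)⁻¹)
    (inv_pos.2 hK).le
    (fun i hi => inv_anti₀ (hpos i hi) ((le_abs_self _).trans (hbd i)))
    (by rw [arctan_inv_of_pos hl0, Finset.sum_congr rfl fun i hi => arctan_inv_of_pos (hpos i hi)]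
        exact hsum)
  have hne : s.Nonempty := Finset.card_pos.1 (by omega)
  have hT : 0 < ∑ i ∈ s, (lam i)⁻¹ := Finset.sum_pos (fun i hi => inv_pos.2 (hpos i hi)) hne
  have hP : (∑ i ∈ s, v i) ^ 2 ≤ (∑ i ∈ s, lam i * v i ^ 2) * ∑ i ∈ s, (lam i)⁻¹ :=
    Finset.sum_sq_le_sum_mul_sum_of_sq_le_mul s
      (fun i hi => mul_nonneg (hpos i hi).le (sq_nonneg _))
      (fun i hi => (inv_pos.2 (hpos i hi)).le)
      (fun i hi => by have := (hpos i hi).ne'; exact le_of_eq (by field_simp))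
  have hl : -lam j * (∑ i ∈ s, (lam i)⁻¹ + 2 / K ^ 3) ≤ 1 := by
    rw [inv_pow, ← div_eq_mul_inv] at hgap
    calc _ ≤ -lam j * (-lam j)⁻¹ := mul_le_mul_of_nonneg_left hgap hl0.le
      _ = 1 := mul_inv_cancel₀ hl0.ne'
  have := quadratic_form_nonneg (x := v j) hT (pow_pos hK 3) hl hP hl0
  rw [← Finset.add_sum_erase _ v (Finset.mem_univ j),
    ← Finset.add_sum_erase _ (fun j => lam j * v j ^ 2) (Finset.mem_univ j)]
  simp only [← hs]
  linarith

lemma convexOn_exp_neg_sum_arctan_line {ι : Type*} [Fintype ι] (A : ℝ) (hA : 0 < A)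
    (x d : ι → ℝ)
    (h : ∀ t ∈ Set.Icc (0 : ℝ) 1, ∀ v : ι → ℝ,
      0 ≤ A * (∑ j, v j) ^ 2 + 2 * ∑ j, (x j + t * d j) * v j ^ 2) :
    ConvexOn ℝ (Set.Icc (0 : ℝ) 1) fun t => exp (-A * ∑ j, arctan (x j + t * d j)) := by
  let g : ℝ → ℝ := fun t => ∑ j, d j / (1 + (x j + t * d j) ^ 2)
  have hlin : ∀ t j, HasDerivAt (fun t : ℝ => x j + t * d j) (d j) t := fun t j => by
    simpa using ((hasDerivAt_id t).mul_const (d j)).const_add (x j)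
  have h1 : ∀ t, HasDerivAt (fun t => exp (-A * ∑ j, arctan (x j + t * d j)))
      (exp (-A * ∑ j, arctan (x j + t * d j)) * (-A * g t)) t := fun t => by
    refine ((HasDerivAt.fun_sum fun j _ => ?_).const_mul (-A)).exp
    simpa [div_eq_inv_mul] using (hlin t j).arctan
  have h2 : ∀ t, HasDerivAt g
      (∑ j, -(2 * (x j + t * d j) * (d j / (1 + (x j + t * d j) ^ 2)) ^ 2)) t := fun t => by
    refine HasDerivAt.fun_sum fun j _ => ?_
    have hne : 1 + (x j + t * d j) ^ 2 ≠ 0 := by positivity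
    refine ((hasDerivAt_const t (d j)).fun_div
      (((hlin t j).fun_pow 2).const_add 1) hne).congr_deriv ?_
    rw [div_pow, mul_div_assoc', ← neg_div]
    congr 1
    push_cast
    ring
  refine convexOn_of_hasDerivWithinAt2_nonneg (convex_Icc 0 1)
    (fun t _ => (h1 t).continuousAt.continuousWithinAt)
    (fun t _ => (h1 t).hasDerivWithinAt)
    (fun t _ => ((h1 t).mul ((h2 t).const_mul (-A))).hasDerivWithinAt) fun t ht => ?_
  have key := h t (interior_subset ht) fun j => d j / (1 + (x j + t * d j) ^ 2)
  have e : ∑ j, -(2 * (x j + t * d j) * (d j / (1 + (x j + t * d j) ^ 2)) ^ 2) =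
      -(2 * ∑ j, (x j + t * d j) * (d j / (1 + (x j + t * d j) ^ 2)) ^ 2) := by
    rw [Finset.sum_neg_distrib, Finset.mul_sum]
    simp only [mul_assoc]
  rw [e]
  have := mul_nonneg (mul_nonneg (exp_pos (-A * ∑ j, arctan (x j + t * d j))).le hA.le) key
  refine this.trans_eq ?_
  simp only [g]
  ring

/-- on the set of λ with ∑ arctan λⱼ ≥ (n−2)π/2 and |λⱼ| ≤ K, the function
λ ↦ −exp(−A·∑ arctan λⱼ) is concave for suitable A = A(n,K) > 0, and the set is convex. -/
theorem exponentiated_arctan_concave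
    (n : ℕ) (hn : 3 ≤ n) (K : ℝ) (hK : 0 < K) :
    Convex ℝ {lam : Fin n → ℝ |
      ((n : ℝ) - 2) * Real.pi / 2 ≤ ∑ j, Real.arctan (lam j) ∧ ∀ j, |lam j| ≤ K} ∧
    ∃ A : ℝ, 0 < A ∧
      ConcaveOn ℝ {lam : Fin n → ℝ |
          ((n : ℝ) - 2) * Real.pi / 2 ≤ ∑ j, Real.arctan (lam j) ∧ ∀ j, |lam j| ≤ K}
        (fun lam => -Real.exp (-A * ∑ j, Real.arctan (lam j))) := by
  have hconv : Convex ℝ {lam : Fin n → ℝ |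
      ((n : ℝ) - 2) * Real.pi / 2 ≤ ∑ j, Real.arctan (lam j) ∧ ∀ j, |lam j| ≤ K} := by
    refine (convex_sum_arctan_ge n (by omega)).inter ?_
    intro x hx y hy a b ha hb hab j
    have hball := convex_Icc (-K) K (abs_le.1 (hx j)) (abs_le.1 (hy j)) ha hb hab
    exact abs_le.2 hball
  refine ⟨hconv, K ^ 3, pow_pos hK 3, hconv, ?_⟩
  intro x hx y hy a b ha hb hab
  have hline := convexOn_exp_neg_sum_arctan_line (K ^ 3) (pow_pos hK 3) x (fun j => y j - x j)
    (fun t ht v => by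
      have hmem := hconv hx hy (sub_nonneg.2 ht.2) ht.1 (by ring)
      have hpt : (1 - t) • x + t • y = fun j => x j + t * (y j - x j) := by
        ext j
        simp only [Pi.add_apply, Pi.smul_apply, smul_eq_mul]
        ring
      rw [hpt] at hmem
      exact exponentiated_arctan_hessian_nonneg hn hK _ v hmem.1 hmem.2)
  have h := hline.2 (Set.left_mem_Icc.2 zero_le_one) (Set.right_mem_Icc.2 zero_le_one) ha hb hab
  have hpt : ∀ j, a * x j + b * y j = x j + b * (y j - x j) := fun j => by
    rw [← sub_eq_iff_eq_add.2 hab.symm]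
    ring
  simp only [smul_eq_mul, mul_zero, mul_one, zero_add, zero_mul, add_zero, one_mul,
    add_sub_cancel] at h
  simp only [Pi.add_apply, Pi.smul_apply, smul_eq_mul, hpt]
  linarith
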